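/- Let s, u ∈ GL_n(𝔽_q) be commuting matrices with s of order coprime to p (semisimple) and u unipotent. For each eigenvalue ξ ∈ K of s, let λ^ξ be the Jordan type of the restriction of u to the eigenspace ker(s − ξ) ⊆ K^n (a partition of dim ker(s − ξ)). Let d be the greatest common divisor of q − 1 together with all the parts of all the partitions λ^ξ, where ξ ranges over the eigenvalues of s. Then the image under the determinant of the centralizer of su in GL_n(𝔽_q) equals {x^d : x ∈ 𝔽_q^×}, the unique subgroup of index d of 𝔽_q^×. -/

import Mathlib

open Module

/-- The `K`-linear endomorphism of `K^n` attached to a matrix `g ∈ GL_n(F)`, where `K` is an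
extension of `F`: extend scalars entrywise and act on column vectors. -/
noncomputable def glToEnd {n : ℕ} {F K : Type*} [Field F] [Field K] [Algebra F K]
    (g : GL (Fin n) F) : Module.End K (Fin n → K) :=
  Matrix.toLin' ((g : Matrix (Fin n) (Fin n) F).map (algebraMap F K))

theorem iSupIndep.finrank_iSup {ι F V : Type*} [Fintype ι] [Field F] [AddCommGroup V]
    [Module F V] [FiniteDimensional F V] {W : ι → Submodule F V} (h : iSupIndep W) :
    finrank F ↥(⨆ i, W i) = ∑ i, finrank F (W i) := by
  classical
  rw [Submodule.iSup_eq_range_dfinsupp_lsum,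
    LinearMap.finrank_range_of_inj h.dfinsupp_lsum_injective]
  exact finrank_directSum (R := F) fun i => W i

theorem Module.End.IsSemisimple.finrank_range_eq_sum {K V : Type*} [Field K] [IsAlgClosed K]
    [AddCommGroup V] [Module K V] [FiniteDimensional K V] {f g : End K V} (hf : f.IsSemisimple)
    (hfg : Commute f g) :
    finrank K (LinearMap.range g) = ∑ μ : f.Eigenvalues, finrank K ((f.eigenspace μ).map g) := by
  have hind : iSupIndep fun μ : f.Eigenvalues => (f.eigenspace μ).map g :=
    (f.eigenspaces_iSupIndep.comp Subtype.val_injective).mono fun μ =>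
      Submodule.map_le_iff_le_comap.2 (End.mapsTo_genEigenspace_of_comm hfg μ 1)
  have htop : ⨆ μ : f.Eigenvalues, f.eigenspace μ = ⊤ := by
    refine top_le_iff.1 (hf.iSup_eigenspace_eq_top.symm.le.trans (iSup_le fun μ => ?_))
    by_cases h : f.HasEigenvalue μ
    · exact le_iSup (fun μ : f.Eigenvalues => f.eigenspace μ) ⟨μ, h⟩
    · rw [End.hasEigenvalue_iff, not_not] at h
      simp [h]
  rw [← hind.finrank_iSup, ← Submodule.map_iSup, htop, Submodule.map_top]

theorem Matrix.rank_map_algebraMap {m F K : Type*} [Fintype m] [DecidableEq m] [Field F] [Field K]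
    [Algebra F K] (A : Matrix m m F) : (A.map (algebraMap F K)).rank = A.rank := by
  obtain ⟨V, U, e, hV, hU, h⟩ := A.exists_rank_normal_form
  have h' := congrArg (algebraMap F K).mapMatrix h
  have hD : (algebraMap F K).mapMatrix ((Matrix.fromBlocks (1 : Matrix (Fin A.rank) (Fin A.rank) F)
      0 0 (0 : Matrix (Fin (Fintype.card m - A.rank)) _ F)).submatrix e e) =
      (Matrix.fromBlocks (1 : Matrix (Fin A.rank) (Fin A.rank) K) 0 0 0).submatrix e e := by
    ext i j
    simp only [RingHom.mapMatrix_apply, Matrix.map_apply, Matrix.submatrix_apply]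
    rcases e i with a | a <;> rcases e j with b | b <;> simp [Matrix.one_apply, apply_ite]
  rw [hD, map_mul, map_mul] at h'
  have hV' : IsUnit ((algebraMap F K).mapMatrix V).det :=
    (Matrix.isUnit_iff_isUnit_det _).1 (hV.map _)
  have hU' : IsUnit ((algebraMap F K).mapMatrix U).det :=
    (Matrix.isUnit_iff_isUnit_det _).1 (hU.map _)
  have hr := congrArg Matrix.rank h'
  rw [Matrix.rank_mul_eq_left_of_isUnit_det _ _ hU', Matrix.rank_mul_eq_right_of_isUnit_det _ _ hV',
    Matrix.rank_submatrix] at hr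
  have hdiag : (Matrix.fromBlocks (1 : Matrix (Fin A.rank) (Fin A.rank) K) 0 0
      (0 : Matrix (Fin (Fintype.card m - A.rank)) _ K)) =
      Matrix.diagonal (Sum.elim (fun _ => 1) fun _ => 0) := by
    rw [← Matrix.fromBlocks_diagonal]; simp
  classical
  rw [hdiag, Matrix.rank_diagonal] at hr
  rw [← RingHom.mapMatrix_apply, hr]
  simp [Fintype.card_subtype, Finset.card_filter, Fintype.sum_sum_type]

theorem LinearMap.det_eq_mul_of_exact {F U V W : Type*} [Field F] [AddCommGroup U] [Module F U]
    [AddCommGroup V] [Module F V] [FiniteDimensional F V] [AddCommGroup W] [Module F W]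
    {i : U →ₗ[F] V} {π : V →ₗ[F] W} (hi : Function.Injective i) (hπ : Function.Surjective π)
    (hex : LinearMap.range i = LinearMap.ker π) {gU : End F U} {gV : End F V} {gW : End F W}
    (h₁ : ∀ x, gV (i x) = i (gU x)) (h₂ : ∀ x, gW (π x) = π (gV x)) :
    LinearMap.det gV = LinearMap.det gU * LinearMap.det gW := by
  have hK : LinearMap.ker π ≤ (LinearMap.ker π).comap gV := fun x hx => by
    simp_all [← h₂]
  rw [LinearMap.det_eq_det_mul_det _ gV hK]
  congr 1
  · let e := (LinearEquiv.ofInjective i hi).trans (LinearEquiv.ofEq _ _ hex)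
    rw [← LinearMap.det_conj gU e]
    congr 1
    ext x
    obtain ⟨y, rfl⟩ := e.surjective x
    rw [LinearMap.comp_apply, LinearMap.comp_apply, LinearEquiv.coe_coe, LinearEquiv.coe_coe,
      e.symm_apply_apply]
    simp [e, h₁]
  · let e := π.quotKerEquivOfSurjective hπ
    rw [← LinearMap.det_conj gW e.symm]
    congr 1
    refine LinearMap.ext fun x => ?_
    obtain ⟨y, rfl⟩ := Submodule.mkQ_surjective _ x
    rw [LinearMap.comp_apply, LinearMap.comp_apply]
    apply e.injective
    simp [e, h₂]

theorem LinearMap.det_restrict_congr {F V : Type*} [Field F] [AddCommGroup V] [Module F V]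
    {g : End F V} {W W' : Submodule F V} (h : W = W') (hW : ∀ x ∈ W, g x ∈ W)
    (hW' : ∀ x ∈ W', g x ∈ W') :
    LinearMap.det (g.restrict hW) = LinearMap.det (g.restrict hW') := by
  subst h; rfl

theorem exists_eq_pow_of_periodic {F : Type*} [CommMonoid F] {c D : ℕ → F} {d m : ℕ}
    (hD : ∀ k, D k = c k * D (k + 1)) (hc : ∀ k, ¬ d ∣ k + 1 → c (k + 1) = c k)
    (hm : D (d * m) = 1) : ∃ y, D 0 = y ^ d := by
  have hcj : ∀ j r, r < d → c (d * j + r) = c (d * j) := by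
    intro j r
    induction r with
    | zero => simp
    | succ r ih =>
      intro hr
      rw [← add_assoc, hc, ih (by omega)]
      rw [add_assoc, Nat.dvd_add_right (dvd_mul_right d j)]
      exact fun h => absurd (Nat.le_of_dvd (by omega) h) (by omega)
  have hDj : ∀ j r, r ≤ d → D (d * j) = c (d * j) ^ r * D (d * j + r) := by
    intro j r
    induction r with
    | zero => simp
    | succ r ih =>
      intro hr
      rw [ih (by omega), hD (d * j + r), hcj j r (by omega), pow_succ, ← add_assoc, mul_assoc]
  have key : ∀ i, D 0 = (∏ j ∈ Finset.range i, c (d * j)) ^ d * D (d * i) := by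
    intro i
    induction i with
    | zero => simp
    | succ i ih =>
      rw [ih, hDj i d le_rfl, Finset.prod_range_succ, mul_pow, mul_assoc, mul_add_one]
  exact ⟨_, by rw [key m, hm, mul_one]⟩

theorem LinearMap.exists_det_eq_pow_of_commute {F V : Type*} [Field F] [AddCommGroup V]
    [Module F V] [FiniteDimensional F V] {N g : End F V} (hN : IsNilpotent N) (hg : Commute g N)
    {d : ℕ} (hd : 0 < d)
    (h : ∀ k, 1 ≤ k → ¬ d ∣ k →
      LinearMap.ker N ⊓ LinearMap.range (N ^ (k - 1)) ≤ LinearMap.range (N ^ k)) :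
    ∃ y, LinearMap.det g = y ^ d := by
  obtain ⟨m, hm⟩ := hN
  have hgx : ∀ k x, g ((N ^ k) x) = (N ^ k) (g x) := fun k x =>
    LinearMap.congr_fun (hg.pow_right k).eq x
  have hR : ∀ k, ∀ x ∈ LinearMap.range (N ^ k), g x ∈ LinearMap.range (N ^ k) := by
    rintro k _ ⟨x, rfl⟩
    exact ⟨g x, (hgx k x).symm⟩
  have hNx : ∀ x, g (N x) = N (g x) := by simpa using hgx 1
  have hK : ∀ k, ∀ x ∈ LinearMap.ker N ⊓ LinearMap.range (N ^ k),
      g x ∈ LinearMap.ker N ⊓ LinearMap.range (N ^ k) := fun k x hx =>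
    ⟨LinearMap.mem_ker.2 (by rw [← hNx, LinearMap.mem_ker.1 hx.1, map_zero]), hR k x hx.2⟩
  have hmap : ∀ k, ∀ x ∈ LinearMap.range (N ^ k), N x ∈ LinearMap.range (N ^ (k + 1)) := by
    rintro k _ ⟨x, rfl⟩
    exact ⟨x, by rw [pow_succ']; rfl⟩
  have h₀ : LinearMap.det g = LinearMap.det (g.restrict (hR 0)) := by
    rw [← LinearMap.det_conj (g.restrict (hR 0))
      (LinearEquiv.ofTop (LinearMap.range (N ^ 0)) (by rw [pow_zero]; exact LinearMap.range_id))]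
    rfl
  rw [h₀]
  refine exists_eq_pow_of_periodic (d := d) (m := m)
    (D := fun k => LinearMap.det (g.restrict (hR k)))
    (c := fun k => LinearMap.det (g.restrict (hK k))) (fun k => ?_) (fun k hk => ?_) ?_
  · refine LinearMap.det_eq_mul_of_exact (i := Submodule.inclusion inf_le_right)
      (π := N.restrict (hmap k)) (Submodule.inclusion_injective _) ?_ ?_ (fun _ => rfl) ?_
    · rintro ⟨_, x, rfl⟩
      exact ⟨⟨(N ^ k) x, x, rfl⟩, Subtype.ext (LinearMap.congr_fun (pow_succ' N k) x).symm⟩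
    · ext ⟨x, hx⟩
      simp [Submodule.range_inclusion, Subtype.ext_iff, LinearMap.restrict_apply]
    · exact fun x => Subtype.ext (hNx x)
  · refine LinearMap.det_restrict_congr (le_antisymm ?_ ?_) _ _
    · refine inf_le_inf_left _ ?_
      rintro _ ⟨x, rfl⟩
      exact ⟨N x, by rw [pow_succ]; rfl⟩
    · exact le_inf inf_le_left (h (k + 1) (by omega) hk)
  · have h0 : N ^ (d * m) = 0 := by rw [mul_comm, pow_mul, hm, zero_pow hd.ne']
    have : Subsingleton (LinearMap.range (N ^ (d * m))) := by
      rw [h0, LinearMap.range_zero]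
      infer_instance
    exact LinearMap.det_eq_one_of_subsingleton _

open Polynomial in
theorem Polynomial.det_lsmul_quotient_pow {F : Type*} [Field F] {p : F[X]} (hp : p ≠ 0) (f : F[X])
    (k : ℕ) :
    LinearMap.det (Algebra.lsmul F F (F[X] ⧸ Ideal.span {p ^ k}) f) =
      LinearMap.det (Algebra.lsmul F F (F[X] ⧸ Ideal.span {p}) f) ^ k := by
  have hfin : ∀ k, FiniteDimensional F (F[X] ⧸ Ideal.span {p ^ k}) := fun k =>
    (AdjoinRoot.powerBasis (pow_ne_zero k hp)).finite
  induction k with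
  | zero =>
    have : Subsingleton (F[X] ⧸ Ideal.span {p ^ 0}) :=
      Ideal.Quotient.subsingleton_iff.2 (by simp)
    rw [pow_zero (LinearMap.det _)]
    exact LinearMap.det_eq_one_of_subsingleton _
  | succ k ih =>
    have hi : Ideal.span {p} ≤
        Submodule.comap (LinearMap.lsmul F[X] F[X] (p ^ k)) (Ideal.span {p ^ (k + 1)}) := by
      intro x hx
      rw [Ideal.mem_span_singleton] at hx
      rw [Submodule.mem_comap, Ideal.mem_span_singleton, pow_succ]
      exact mul_dvd_mul_left _ hx
    have hπ : Ideal.span {p ^ (k + 1)} ≤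
        Submodule.comap (LinearMap.id (R := F[X])) (Ideal.span {p ^ k}) := by
      intro x hx
      rw [Ideal.mem_span_singleton] at hx
      rw [Submodule.mem_comap, LinearMap.id_apply, Ideal.mem_span_singleton]
      exact (pow_dvd_pow _ k.le_succ).trans hx
    rw [pow_succ' (LinearMap.det _), ← ih]
    refine LinearMap.det_eq_mul_of_exact
      (i := (Submodule.mapQ _ _ _ hi).restrictScalars F)
      (π := (Submodule.mapQ _ _ _ hπ).restrictScalars F) ?_ ?_ ?_ ?_ ?_
    · rw [injective_iff_map_eq_zero]
      intro x hx
      obtain ⟨x, rfl⟩ := Ideal.Quotient.mk_surjective x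
      have hx' : p ^ (k + 1) ∣ p ^ k * x :=
        Ideal.mem_span_singleton.1 (Ideal.Quotient.eq_zero_iff_mem.1 hx)
      rw [pow_succ, mul_dvd_mul_iff_left (pow_ne_zero k hp)] at hx'
      exact Ideal.Quotient.eq_zero_iff_mem.2 (Ideal.mem_span_singleton.2 hx')
    · intro x
      obtain ⟨x, rfl⟩ := Ideal.Quotient.mk_surjective x
      exact ⟨Ideal.Quotient.mk _ x, rfl⟩
    · ext x
      obtain ⟨x, rfl⟩ := Ideal.Quotient.mk_surjective x
      constructor
      · rintro ⟨y, hy⟩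
        obtain ⟨y, rfl⟩ := Ideal.Quotient.mk_surjective y
        rw [← hy]
        exact Ideal.Quotient.eq_zero_iff_mem.2 (Ideal.mem_span_singleton.2 (dvd_mul_right _ _))
      · intro hx
        obtain ⟨y, rfl⟩ : p ^ k ∣ x :=
          Ideal.mem_span_singleton.1 (Ideal.Quotient.eq_zero_iff_mem.1 hx)
        exact ⟨Ideal.Quotient.mk _ y, rfl⟩
    · intro x
      exact ((Submodule.mapQ _ _ _ hi).map_smul f x).symm
    · intro x
      exact ((Submodule.mapQ _ _ _ hπ).map_smul f x).symm

open Polynomial in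
theorem Polynomial.exists_det_lsmul_quotient_eq {F : Type*} [Field F] [Finite F] {p : F[X]}
    (hp : Irreducible p) (y : F) :
    ∃ f : F[X], LinearMap.det (Algebra.lsmul F F (F[X] ⧸ Ideal.span {p}) f) = y := by
  have : (Ideal.span {p}).IsMaximal := PrincipalIdealRing.isMaximal_of_irreducible hp
  let : Field (F[X] ⧸ Ideal.span {p}) := Ideal.Quotient.field _
  have : FiniteDimensional F (F[X] ⧸ Ideal.span {p}) := (AdjoinRoot.powerBasis hp.ne_zero).finite
  have : Finite (F[X] ⧸ Ideal.span {p}) := Module.finite_of_finite F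
  obtain ⟨x, hx⟩ := FiniteField.norm_surjective F (F[X] ⧸ Ideal.span {p}) y
  obtain ⟨f, rfl⟩ := Ideal.Quotient.mk_surjective x
  exact ⟨f, hx⟩

theorem exists_pow_dvd_pow_mul_sub {R : Type*} [CommRing R] [IsDomain R] {p c x : R} (hp : p ≠ 0)
    (hc : IsCoprime p c) {e k : ℕ} (hk : 1 ≤ k) (hek : e ≠ k) (hx : p ^ e ∣ (p * c) ^ k * x) :
    ∃ z, p ^ e ∣ (p * c) ^ (k - 1) * x - (p * c) ^ k * z := by
  obtain ⟨k, rfl⟩ : ∃ l, k = l + 1 := ⟨k - 1, by omega⟩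
  rw [Nat.add_sub_cancel]
  rcases lt_or_gt_of_ne hek with h | h
  · refine ⟨0, ?_⟩
    rw [mul_zero, sub_zero, mul_pow, mul_assoc]
    exact dvd_mul_of_dvd_left (pow_dvd_pow _ (by omega)) _
  · obtain ⟨j, rfl⟩ : ∃ j, e = (k + 1) + (j + 1) := ⟨e - k - 2, by omega⟩
    rw [mul_pow, mul_assoc, pow_add, mul_dvd_mul_iff_left (pow_ne_zero _ hp)] at hx
    obtain ⟨w, rfl⟩ : p ∣ x :=
      (dvd_pow_self p j.succ_ne_zero).trans
        ((hc.pow (m := j + 1) (n := k + 1)).dvd_of_dvd_mul_left hx)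
    obtain ⟨b, a, hab⟩ := hc.pow_left (m := (k + 1) + (j + 1))
    refine ⟨a * w, (p * c) ^ k * p * w * b, ?_⟩
    linear_combination (p * c) ^ k * p * w * -hab

open Polynomial in
theorem Module.End.exists_commute_det_eq_pow {F V : Type*} [Field F] [Finite F] [AddCommGroup V]
    [Module F V] [FiniteDimensional F V] {A : End F V} {h : F[X]} (hsq : Squarefree h)
    (hN : IsNilpotent (aeval A h)) {k : ℕ} (hk : 1 ≤ k) {x : V} (hx : (aeval A h ^ k) x = 0)
    (hx' : (aeval A h ^ (k - 1)) x ∉ LinearMap.range (aeval A h ^ k)) (y : F) :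
    ∃ g : End F V, Commute g A ∧ LinearMap.det g = y ^ k := by
  classical
  obtain ⟨ι, _, p, hp, e, ⟨Φ⟩⟩ := Module.equiv_directSum_of_isTorsion
    (Module.AEval.isTorsion_of_finiteDimensional F V A)
  let of := AEval.of F V A
  have hof : ∀ (f : F[X]) v, of ((aeval A f) v) = f • of v := AEval.of_aeval_smul A
  have hcomp : ∀ (r : F[X]) (v : DirectSum ι fun i => F[X] ⧸ F[X] ∙ p i ^ e i) i,
      (r • v) i = r • v i :=
    fun r v i => DirectSum.smul_apply r v i
  obtain ⟨i, rfl⟩ : ∃ i, e i = k := by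
    by_contra! hek
    have hz : ∀ i, ∃ z, h ^ (k - 1) • (Φ (of x)) i = h ^ k • z := by
      intro i
      obtain ⟨w, hw⟩ := Ideal.Quotient.mk_surjective ((Φ (of x)) i)
      rw [← hw]
      have hdvd : p i ^ e i ∣ h ^ k * w := by
        have : h ^ k • (Φ (of x)) i = 0 := by
          rw [← hcomp, ← map_smul, ← hof, map_pow, hx]; simp
        rw [← hw] at this
        exact Ideal.mem_span_singleton.1 (Ideal.Quotient.eq_zero_iff_mem.1 this)
      suffices ∃ z, p i ^ e i ∣ h ^ (k - 1) * w - h ^ k * z by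
        obtain ⟨z, hz⟩ := this
        exact ⟨Ideal.Quotient.mk _ z, Ideal.Quotient.eq.2 (Ideal.mem_span_singleton.2 hz)⟩
      rcases Nat.eq_zero_or_pos (e i) with he | he
      · exact ⟨0, by simp [he]⟩
      obtain ⟨n, hn⟩ := hN
      have hph : p i ^ e i ∣ h ^ n := by
        have h0 : h ^ n • DirectSum.lof F[X] ι (fun i => F[X] ⧸ F[X] ∙ p i ^ e i) i
            (Ideal.Quotient.mk _ 1) = 0 := by
          obtain ⟨v, hv⟩ := (of.toEquiv.trans Φ.toEquiv).surjective
            (DirectSum.lof F[X] ι (fun i => F[X] ⧸ F[X] ∙ p i ^ e i) i (Ideal.Quotient.mk _ 1))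
          rw [← hv]
          change h ^ n • Φ (of v) = 0
          rw [← map_smul, ← hof, map_pow, hn]; simp
        rw [← map_smul] at h0
        have h1 := congrArg (fun v => v i) h0
        simp only [DirectSum.lof_apply] at h1
        have h2 : h ^ n * 1 ∈ Ideal.span {p i ^ e i} := Ideal.Quotient.eq_zero_iff_mem.1 h1
        rwa [mul_one, Ideal.mem_span_singleton] at h2
      obtain ⟨c, rfl⟩ : p i ∣ h :=
        (hp i).prime.dvd_of_dvd_pow ((dvd_pow_self _ he.ne').trans hph)
      refine exists_pow_dvd_pow_mul_sub (hp i).ne_zero ?_ hk (hek i) hdvd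
      refine (hp i).coprime_iff_not_dvd.2 fun hc => (hp i).not_isUnit (hsq _ ?_)
      exact mul_dvd_mul_left _ hc
    choose z hz using hz
    apply hx'
    refine ⟨of.symm (Φ.symm ((DirectSum.linearEquivFunOnFintype F[X] ι _).symm z)), ?_⟩
    apply of.injective
    apply Φ.injective
    rw [← map_pow, ← map_pow, hof, hof, of.apply_symm_apply, map_smul, map_smul,
      Φ.apply_symm_apply]
    refine DFinsupp.ext fun i => ?_
    refine (hcomp _ _ i).trans (Eq.trans ?_ (hcomp _ _ i).symm)
    rw [hz i]
    rfl
  obtain ⟨f, hf⟩ := exists_det_lsmul_quotient_eq (hp i) y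
  have : FiniteDimensional F (AEval F V A) := Module.Finite.equiv of
  let incl := Φ.symm.toLinearMap ∘ₗ DirectSum.lof F[X] ι (fun i => F[X] ⧸ F[X] ∙ p i ^ e i) i
  let proj := DirectSum.component F[X] ι (fun i => F[X] ⧸ F[X] ∙ p i ^ e i) i ∘ₗ Φ.toLinearMap
  have hproj : ∀ v, proj (incl v) = v := fun v => by
    simp [proj, incl, DirectSum.component.lof_self]
  let g := LinearMap.id + (f - 1) • incl ∘ₗ proj
  have hgi : ∀ v, g (incl v) = incl (f • v) := fun v => by
    simp [g, hproj, sub_smul]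
  refine ⟨of.symm.conj (g.restrictScalars F), ?_, ?_⟩
  · refine LinearMap.ext fun v => of.injective ?_
    have hX : ∀ v, of (A v) = (X : F[X]) • of v := fun v => by simpa using hof X v
    simp only [Module.End.mul_apply, LinearEquiv.conj_apply, LinearMap.comp_apply,
      LinearEquiv.coe_coe, LinearEquiv.symm_symm, LinearMap.restrictScalars_apply,
      of.apply_symm_apply, hX, map_smul]
  · refine (LinearMap.det_conj (g.restrictScalars F) of.symm).trans ?_
    have hincl : Function.Injective incl := Function.LeftInverse.injective hproj
    rw [LinearMap.det_eq_mul_of_exact (i := incl.restrictScalars F)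
      (π := (LinearMap.range (incl.restrictScalars F)).mkQ) (gU := Algebra.lsmul F F _ f)
      (gW := LinearMap.id) hincl (Submodule.mkQ_surjective _) (Submodule.ker_mkQ _).symm hgi ?_,
      LinearMap.det_id, mul_one]
    · exact (det_lsmul_quotient_pow (hp i).ne_zero f (e i)).trans (by rw [hf])
    · intro v
      refine (Submodule.Quotient.eq _).2 ⟨-((f - 1) • proj v), ?_⟩
      simp [g]

theorem LinearMap.finrank_ker_inf_range_pow {F V : Type*} [Field F] [AddCommGroup V] [Module F V]
    [FiniteDimensional F V] (N : End F V) (k : ℕ) :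
    finrank F ↥(LinearMap.ker N ⊓ LinearMap.range (N ^ k)) +
      finrank F (LinearMap.range (N ^ (k + 1))) = finrank F (LinearMap.range (N ^ k)) := by
  have h := (N.domRestrict (LinearMap.range (N ^ k))).finrank_range_add_finrank_ker
  rw [LinearMap.range_domRestrict, ← LinearMap.range_comp, ← Module.End.mul_eq_comp, ← pow_succ',
    LinearMap.ker_domRestrict] at h
  rw [← h, add_comm, inf_comm, ← Submodule.map_comap_subtype,
    Submodule.finrank_map_subtype_eq]

theorem Multiset.countP_le_eq_count_add (T : Multiset ℕ) (k : ℕ) :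
    T.countP (k ≤ ·) = T.count k + T.countP (k + 1 ≤ ·) := by
  induction T using Multiset.induction_on with
  | empty => simp
  | cons a T ih =>
    simp only [Multiset.countP_cons, Multiset.count_cons, ih]
    grind

/-- If `T` is the Jordan type of `N`, encoded by the dimensions of `ker N ⊓ range N ^ k`, then its
parts are the places where this decreasing sequence of subspaces drops. -/
theorem LinearMap.ker_inf_range_pow_le_iff {F V : Type*} [Field F] [AddCommGroup V] [Module F V]
    [FiniteDimensional F V] {N : End F V} {T : Multiset ℕ}
    (hT : ∀ k, finrank F ↥(LinearMap.ker N ⊓ LinearMap.range (N ^ k)) = T.countP (k + 1 ≤ ·))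
    {k : ℕ} (hk : 1 ≤ k) :
    LinearMap.ker N ⊓ LinearMap.range (N ^ (k - 1)) ≤ LinearMap.range (N ^ k) ↔ k ∉ T := by
  obtain ⟨k, rfl⟩ : ∃ l, k = l + 1 := ⟨k - 1, by omega⟩
  rw [Nat.add_sub_cancel, ← Multiset.count_eq_zero]
  have hle : LinearMap.ker N ⊓ LinearMap.range (N ^ (k + 1)) ≤
      LinearMap.ker N ⊓ LinearMap.range (N ^ k) := by
    refine inf_le_inf_left _ ?_
    rw [pow_succ]
    exact LinearMap.range_comp_le_range _ _
  have hcount := T.countP_le_eq_count_add (k + 1)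
  rw [← hT, ← hT] at hcount
  constructor
  · intro h
    rw [le_antisymm hle (le_inf inf_le_left h)] at hcount
    omega
  · intro h
    rw [← Submodule.eq_of_le_of_finrank_eq hle (by omega)]
    exact inf_le_right

theorem Module.End.IsSemisimple.finrank_ker_inf_range_pow_eq_countP {K V : Type*} [Field K]
    [IsAlgClosed K] [AddCommGroup V] [Module K V] [FiniteDimensional K V] {f N : End K V}
    (hf : f.IsSemisimple) (hfN : Commute f N) {Λ : K → Multiset ℕ}
    (hΛ : ∀ μ : K, f.HasEigenvalue μ → ∀ k : ℕ, 1 ≤ k →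
      ((Λ μ).filter (fun i => k ≤ i)).card =
        finrank K ((f.eigenspace μ).map (N ^ (k - 1))) - finrank K ((f.eigenspace μ).map (N ^ k)))
    (k : ℕ) :
    finrank K ↥(LinearMap.ker N ⊓ LinearMap.range (N ^ k)) =
      (∑ μ : f.Eigenvalues, Λ μ).countP (k + 1 ≤ ·) := by
  have h := LinearMap.finrank_ker_inf_range_pow N k
  rw [hf.finrank_range_eq_sum (hfN.pow_right k),
    hf.finrank_range_eq_sum (hfN.pow_right (k + 1))] at h
  have hsum : ∑ μ : f.Eigenvalues, finrank K ((f.eigenspace μ).map (N ^ k)) =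
      ∑ μ : f.Eigenvalues, (Λ μ).countP (k + 1 ≤ ·) +
        ∑ μ : f.Eigenvalues, finrank K ((f.eigenspace μ).map (N ^ (k + 1))) := by
    rw [← Finset.sum_add_distrib]
    refine Finset.sum_congr rfl fun μ _ => ?_
    have hle : finrank K ((f.eigenspace μ).map (N ^ (k + 1))) ≤
        finrank K ((f.eigenspace μ).map (N ^ k)) := by
      rw [pow_succ', Module.End.mul_eq_comp, Submodule.map_comp]
      exact Submodule.finrank_map_le _ _
    rw [Multiset.countP_eq_card_filter, hΛ μ μ.2 (k + 1) (by omega), Nat.add_sub_cancel]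
    omega
  rw [hsum] at h
  rw [← Multiset.coe_countPAddMonoidHom, map_sum]
  simpa using h

theorem Matrix.finrank_range_toLin'_map {m F K : Type*} [Fintype m] [DecidableEq m] [Field F]
    [Field K] [Algebra F K] (A : Matrix m m F) :
    finrank K (LinearMap.range (Matrix.toLin' (A.map (algebraMap F K)))) =
      finrank F (LinearMap.range (Matrix.toLin' A)) :=
  A.rank_map_algebraMap

theorem Matrix.finrank_ker_inf_range_pow_map {m F K : Type*} [Fintype m] [DecidableEq m] [Field F]
    [Field K] [Algebra F K] (A : Matrix m m F) (k : ℕ) :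
    finrank K ↥(LinearMap.ker (Matrix.toLin' (A.map (algebraMap F K))) ⊓
        LinearMap.range (Matrix.toLin' (A.map (algebraMap F K)) ^ k)) =
      finrank F ↥(LinearMap.ker (Matrix.toLin' A) ⊓ LinearMap.range (Matrix.toLin' A ^ k)) := by
  have hr : ∀ k, finrank K (LinearMap.range (Matrix.toLin' (A.map (algebraMap F K)) ^ k)) =
      finrank F (LinearMap.range (Matrix.toLin' A ^ k)) := fun k => by
    rw [← Matrix.toLin'_pow, ← Matrix.toLin'_pow, ← Matrix.map_pow, finrank_range_toLin'_map]
  have h₁ := LinearMap.finrank_ker_inf_range_pow (Matrix.toLin' (A.map (algebraMap F K))) k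
  have h₂ := LinearMap.finrank_ker_inf_range_pow (Matrix.toLin' A) k
  rw [hr, hr] at h₁
  omega

theorem exists_mul_pow_eq_of_coprime_order {G : Type*} [Group G] {s u : G} (hsu : Commute s u)
    {p a : ℕ} (hs : (orderOf s).Coprime p) (hu : u ^ p ^ a = 1) (hp : 1 < p) :
    ∃ L, (s * u) ^ L = u ∧ ¬ p ∣ L := by
  have hu' : u ^ p ^ (a + 1) = 1 := by rw [pow_succ, pow_mul, hu, one_pow]
  obtain ⟨L, hL₀, hL₁⟩ := Nat.chineseRemainder (hs.pow_right (a + 1)) 0 1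
  refine ⟨L, ?_, fun hL => ?_⟩
  · have hus : u ^ L = u ^ 1 := pow_eq_pow_iff_modEq.2 (hL₁.of_dvd (orderOf_dvd_of_pow_eq_one hu'))
    rw [hsu.mul_pow, orderOf_dvd_iff_pow_eq_one.1 ((Nat.modEq_zero_iff_dvd).1 hL₀), one_mul, hus,
      pow_one]
  · have h1 := hL₁.of_dvd (dvd_pow_self p a.succ_ne_zero)
    have := (Nat.modEq_zero_iff_dvd.2 hL).symm.trans h1
    have := (Nat.modEq_zero_iff_dvd.1 this.symm)
    exact absurd (Nat.le_of_dvd one_pos this) (by omega)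

theorem Matrix.GeneralLinearGroup.exists_pow_prime_pow_eq_one {F : Type*} [Field F] {n p : ℕ}
    [Fact p.Prime] [CharP F p] {u : GL (Fin n) F}
    (hu : IsNilpotent ((u : Matrix (Fin n) (Fin n) F) - 1)) : ∃ a, u ^ p ^ a = 1 := by
  obtain ⟨m, hm⟩ := hu
  refine ⟨m, Units.ext ?_⟩
  rcases isEmpty_or_nonempty (Fin n) with _ | _
  · exact Subsingleton.elim _ _
  have h := sub_pow_expChar_pow_of_commute (p := p) (n := m)
    (Commute.one_right (u : Matrix (Fin n) (Fin n) F))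
  rw [pow_eq_zero_of_le (Nat.lt_pow_self (Fact.out : p.Prime).one_lt).le hm, one_pow] at h
  rw [Units.val_pow_eq_pow_val, Units.val_one]
  exact (sub_eq_zero.1 h.symm)

theorem isSemisimple_glToEnd {F K : Type*} [Field F] [Field K] [Algebra F K] {n p : ℕ}
    (hp : p.Prime) [CharP F p] {s : GL (Fin n) F} (hs : (orderOf s).Coprime p) :
    (glToEnd (K := K) s).IsSemisimple := by
  have : CharP K p := charP_of_injective_algebraMap (algebraMap F K).injective p
  have hm : (orderOf s : K) ≠ 0 := by
    rw [Ne, CharP.cast_eq_zero_iff K p]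
    exact fun h => hp.one_lt.ne' (Nat.dvd_one.1 (hs ▸ Nat.dvd_gcd h dvd_rfl))
  refine End.isSemisimple_of_squarefree_aeval_eq_zero
    (Polynomial.X_pow_sub_one_separable_iff.2 hm).squarefree ?_
  rw [map_sub, map_pow, Polynomial.aeval_X, map_one, glToEnd, ← Matrix.toLin'_pow,
    ← Matrix.map_pow, ← Units.val_pow_eq_pow_val, pow_orderOf_eq_one, Units.val_one,
    Matrix.map_one _ (map_zero _) (map_one _), Matrix.toLin'_one]
  exact sub_self _

theorem glToEnd_commute {F K : Type*} [Field F] [Field K] [Algebra F K] {n : ℕ}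
    {s u : GL (Fin n) F} (h : s * u = u * s) :
    Commute (glToEnd (K := K) s) (glToEnd (K := K) u) := by
  have h' := congrArg (fun g : GL (Fin n) F =>
    Matrix.toLin' ((g : Matrix (Fin n) (Fin n) F).map (algebraMap F K))) h
  simp only [Units.val_mul, Matrix.map_mul, Matrix.toLin'_mul] at h'
  exact h'

theorem glToEnd_sub_one {F K : Type*} [Field F] [Field K] [Algebra F K] {n : ℕ}
    (u : GL (Fin n) F) : glToEnd (K := K) u - 1 =
      Matrix.toLin' (((u : Matrix (Fin n) (Fin n) F) - 1).map (algebraMap F K)) := by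
  rw [Matrix.map_sub _ (map_sub _), Matrix.map_one _ (map_zero _) (map_one _), map_sub,
    Matrix.toLin'_one]
  rfl

open Polynomial in
theorem Matrix.GeneralLinearGroup.det_image_centralizer {F : Type*} [Field F] [Fintype F] {n : ℕ}
    {g u : GL (Fin n) F} (hu : IsNilpotent ((u : Matrix (Fin n) (Fin n) F) - 1)) {L : ℕ}
    (hL : g ^ L = u) (hL₀ : (L : F) ≠ 0) {T : Multiset ℕ} (hTpos : ∀ i ∈ T, 0 < i)
    (hT : ∀ k, finrank F ↥(LinearMap.ker (Matrix.toLin' ((u : Matrix (Fin n) (Fin n) F) - 1)) ⊓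
      LinearMap.range (Matrix.toLin' ((u : Matrix (Fin n) (Fin n) F) - 1) ^ k)) =
        T.countP (k + 1 ≤ ·))
    {d : ℕ} (hd : ∀ t, t ∣ d ↔ t ∣ Fintype.card F - 1 ∧ ∀ i ∈ T, t ∣ i) :
    (Subgroup.centralizer {g}).map Matrix.GeneralLinearGroup.det =
      (powMonoidHom d : Fˣ →* Fˣ).range := by
  set N := Matrix.toLin' ((u : Matrix (Fin n) (Fin n) F) - 1) with hNdef
  have hN : IsNilpotent N := hu.map Matrix.toLinAlgEquiv'
  have hd₀ : 0 < d := by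
    refine Nat.pos_of_dvd_of_pos ((hd d).1 dvd_rfl).1 (Nat.sub_pos_of_lt Fintype.one_lt_card)
  apply le_antisymm
  · rintro _ ⟨x, hx, rfl⟩
    have hxg : Commute x g := Subgroup.mem_centralizer_singleton_iff.1 hx
    have hxu : Commute x u := hL ▸ hxg.pow_right L
    have hxN : Commute (Matrix.toLin' (x : Matrix (Fin n) (Fin n) F)) N :=
      ((hxu.units_val).sub_right (Commute.one_right _)).map Matrix.toLinAlgEquiv'
    obtain ⟨y, hy⟩ := LinearMap.exists_det_eq_pow_of_commute hN hxN hd₀ fun k hk hdk =>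
      (LinearMap.ker_inf_range_pow_le_iff hT hk).2 fun hkT => hdk (((hd d).1 dvd_rfl).2 k hkT)
    rw [LinearMap.det_toLin'] at hy
    have hy₀ : y ≠ 0 := by
      rintro rfl
      rw [zero_pow hd₀.ne'] at hy
      exact (Matrix.GeneralLinearGroup.det x).ne_zero hy
    exact ⟨Units.mk0 y hy₀, Units.ext hy.symm⟩
  · set H := (Subgroup.centralizer {g}).map Matrix.GeneralLinearGroup.det with hH
    have hexp : ∀ k, (∀ y : Fˣ, y ^ k ∈ H) → Monoid.exponent (Fˣ ⧸ H) ∣ k := fun k hk => by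
      refine Monoid.exponent_dvd_of_forall_pow_eq_one fun y => ?_
      obtain ⟨y, rfl⟩ := QuotientGroup.mk_surjective y
      exact (QuotientGroup.eq_one_iff (y ^ k)).2 (hk y)
    have key : Monoid.exponent (Fˣ ⧸ H) ∣ d := by
      refine (hd _).2 ⟨hexp _ fun y => ?_, fun k hk => hexp k fun y => ?_⟩
      · classical
        rw [← Fintype.card_units, pow_card_eq_one]
        exact H.one_mem
      · have hA : aeval (Matrix.toLin' (g : Matrix (Fin n) (Fin n) F)) (X ^ L - 1 : F[X]) = N := by
          rw [map_sub, map_pow, aeval_X, map_one, ← Matrix.toLin'_pow,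
            ← Units.val_pow_eq_pow_val, hL, hNdef, map_sub, Matrix.toLin'_one]
          rfl
        have hne := mt (LinearMap.ker_inf_range_pow_le_iff hT (hTpos k hk)).1 (not_not.2 hk)
        obtain ⟨_, ⟨hker, x, rfl⟩, hx⟩ := SetLike.not_le_iff_exists.1 hne
        have hker' : (N ^ k) x = 0 := by
          rw [← Nat.sub_add_cancel (hTpos k hk), pow_succ']
          exact hker
        rw [← hA] at hN hker' hx
        obtain ⟨f, hfg, hf⟩ := End.exists_commute_det_eq_pow
          (X_pow_sub_one_separable_iff.2 hL₀).squarefree hN (hTpos k hk) hker' hx y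
        have hdet : (LinearMap.toMatrix' f).det = ((y ^ k : Fˣ) : F) := by
          rw [LinearMap.det_toMatrix', hf, Units.val_pow_eq_pow_val]
        let z := Matrix.GeneralLinearGroup.mkOfDetNeZero (LinearMap.toMatrix' f)
          (by rw [hdet]; exact Units.ne_zero _)
        refine ⟨z, Subgroup.mem_centralizer_singleton_iff.2 (Units.ext ?_), Units.ext hdet⟩
        have := congrArg LinearMap.toMatrix' hfg.eq
        rwa [LinearMap.toMatrix'_mul, LinearMap.toMatrix'_mul, LinearMap.toMatrix'_toLin'] at this
    rintro _ ⟨y, rfl⟩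
    refine (QuotientGroup.eq_one_iff (y ^ d)).1 ?_
    exact Monoid.exponent_dvd_iff_forall_pow_eq_one.1 key (y : Fˣ ⧸ H)

/-- general linear case of the determinant computation in Proposition 4.6 of
the paper.  Let `s, u ∈ GL_n(𝔽_q)` be commuting matrices, `s` of order coprime to `p`
(semisimple) and `u` unipotent.  For each eigenvalue `ξ` of `s` over an algebraic closure `K`,
let `Λ ξ` be the Jordan type of the restriction of `u` to `ker (s - ξ)` (a partition of
`dim ker (s - ξ)`, recorded by ranks of the powers of `u - 1` on `ker (s - ξ)`).  Let `d` be
the gcd of `q - 1` and all parts of all `Λ ξ`.  Then the image under the determinant of the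
centralizer of `su` in `GL_n(𝔽_q)` equals `{x^d : x ∈ 𝔽_q^×}`. -/
theorem stmt11 {p q : ℕ} (hp : p.Prime) (k₀ : ℕ) (hk₀ : 0 < k₀) (hq : q = p ^ k₀)
    {n : ℕ} (hn : 1 ≤ n)
    (Fq : Type*) [Field Fq] [Fintype Fq] (hcard : Fintype.card Fq = q)
    (K : Type*) [Field K] [IsAlgClosed K] [Algebra Fq K]
    (s u : GL (Fin n) Fq)
    (hsu : s * u = u * s)
    (hs : Nat.Coprime (orderOf s) p)
    (hu : IsNilpotent ((u : Matrix (Fin n) (Fin n) Fq) - 1))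
    (Λ : K → Multiset ℕ)
    (hΛpos : ∀ ξ : K, (glToEnd (K := K) s).HasEigenvalue ξ → ∀ i ∈ Λ ξ, 0 < i)
    (hΛsum : ∀ ξ : K, (glToEnd (K := K) s).HasEigenvalue ξ →
      (Λ ξ).sum = finrank K ((glToEnd (K := K) s).eigenspace ξ))
    (hΛrank : ∀ ξ : K, (glToEnd (K := K) s).HasEigenvalue ξ → ∀ k : ℕ, 1 ≤ k →
      ((Λ ξ).filter (fun i => k ≤ i)).card =
        finrank K (((glToEnd (K := K) s).eigenspace ξ).map ((glToEnd (K := K) u - 1) ^ (k - 1)))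
          - finrank K (((glToEnd (K := K) s).eigenspace ξ).map ((glToEnd (K := K) u - 1) ^ k)))
    (d : ℕ)
    (hd : ∀ t : ℕ, t ∣ d ↔ (t ∣ q - 1 ∧
      ∀ ξ : K, (glToEnd (K := K) s).HasEigenvalue ξ → ∀ i ∈ Λ ξ, t ∣ i)) :
    (fun g : GL (Fin n) Fq => (g : Matrix (Fin n) (Fin n) Fq).det) ''
        {g : GL (Fin n) Fq | g * (s * u) = (s * u) * g}
      = {x : Fq | ∃ y : Fqˣ, x = (y : Fq) ^ d} := by
  have : Fact p.Prime := ⟨hp⟩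
  have : CharP Fq p := charP_of_card_eq_prime_pow (hcard.trans hq)
  obtain ⟨a, ha⟩ := Matrix.GeneralLinearGroup.exists_pow_prime_pow_eq_one (p := p) hu
  obtain ⟨L, hL, hpL⟩ := exists_mul_pow_eq_of_coprime_order hsu hs ha hp.one_lt
  have hL₀ : (L : Fq) ≠ 0 := by rwa [Ne, CharP.cast_eq_zero_iff Fq p]
  set T : Multiset ℕ := ∑ μ : (glToEnd (K := K) s).Eigenvalues, Λ μ with hT
  have hmem : ∀ i, i ∈ T ↔ ∃ ξ, (glToEnd (K := K) s).HasEigenvalue ξ ∧ i ∈ Λ ξ := fun i => by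
    rw [hT, Multiset.mem_sum]
    exact ⟨fun ⟨μ, _, h⟩ => ⟨μ, μ.2, h⟩, fun ⟨ξ, hξ, h⟩ => ⟨⟨ξ, hξ⟩, Finset.mem_univ _, h⟩⟩
  have key := Matrix.GeneralLinearGroup.det_image_centralizer hu hL hL₀ (T := T) (d := d)
    (fun i hi => by
      obtain ⟨ξ, hξ, h⟩ := (hmem i).1 hi
      exact hΛpos ξ hξ i h)
    (fun k => by
      rw [← Matrix.finrank_ker_inf_range_pow_map (K := K), ← glToEnd_sub_one]
      exact (isSemisimple_glToEnd hp hs).finrank_ker_inf_range_pow_eq_countP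
        ((glToEnd_commute hsu).sub_right (Commute.one_right _)) hΛrank k)
    (fun t => by
      rw [hd, hcard]
      refine and_congr_right fun _ => ⟨fun h i hi => ?_, fun h ξ hξ i hi =>
        h i ((hmem i).2 ⟨ξ, hξ, hi⟩)⟩
      obtain ⟨ξ, hξ, hi⟩ := (hmem i).1 hi
      exact h ξ hξ i hi)
  ext x
  constructor
  · rintro ⟨g, hg, rfl⟩
    obtain ⟨y, hy⟩ := key.le ⟨g, Subgroup.mem_centralizer_singleton_iff.2 hg, rfl⟩
    exact ⟨y, (congrArg Units.val hy).symm⟩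
  · rintro ⟨y, rfl⟩
    obtain ⟨g, hg, hgy⟩ := key.ge ⟨y, rfl⟩
    exact ⟨g, Subgroup.mem_centralizer_singleton_iff.1 hg, congrArg Units.val hgy⟩
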